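/- arXiv:2402.17142 — 2 statements merged into one kernel-verified Lean document; each statement's English description precedes it below -/
import Mathlib

section
/- Let H be a CDF on Θ with max{0, (F(x)−q)/(1−q)} ≤ H(x) ≤ min{F(x)/q, 1} for all x. Then for every ω ∈ [0,q], H^{-1}(ω/q) ∈ [F^{-1}(ω), F^{-1}(q + (1−q)ω/q)], i.e., H^{-1}(ω/q) is a q-quantile of the posterior G_ω of the q-quantile matching experiment. -/
open MeasureTheory Set Filter

noncomputable section

/-- A CDF on `[a,b]`: nondecreasing, right-continuous, `0` below `a`, `1` from `b` on. -/
def IsCDF (a b : ℝ) (G : ℝ → ℝ) : Prop :=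
  Monotone G ∧ (∀ x : ℝ, ContinuousWithinAt G (Set.Ici x) x) ∧
    (∀ x : ℝ, x < a → G x = 0) ∧ (∀ x : ℝ, b ≤ x → G x = 1)

/-- The set of `q`-quantiles of `G` on `[a,b]`. -/
def QSet (a b q : ℝ) (G : ℝ → ℝ) : Set ℝ :=
  {x | x ∈ Set.Icc a b ∧ Function.leftLim G x ≤ q ∧ q ≤ G x}

/-- Generalized inverse `G⁻¹(p) = inf {θ ∈ [a,b] : G θ ≥ p}`. -/
def ginv (a b : ℝ) (G : ℝ → ℝ) (p : ℝ) : ℝ :=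
  sInf {θ | θ ∈ Set.Icc a b ∧ p ≤ G θ}

/-- if `H̲ ≤ H ≤ H̄`, then `H⁻¹(ω/q)` lies in
`[F⁻¹(ω), F⁻¹(q+(1-q)ω/q)]`, i.e. it is a `q`-quantile of the matching posterior `G_ω`. -/
theorem ginv_mem_matching_interval (a b q : ℝ) (hab : a < b)
    (hq : q ∈ Set.Ioo (0 : ℝ) 1) (F : ℝ → ℝ) (hF : IsCDF a b F)
    (H : ℝ → ℝ) (hH : IsCDF a b H)
    (hbounds : ∀ x ∈ Set.Icc a b,
      max 0 ((F x - q) / (1 - q)) ≤ H x ∧ H x ≤ min (F x / q) 1)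
    (ω : ℝ) (hω : ω ∈ Set.Icc 0 q) :
    ginv a b H (ω / q) ∈ Set.Icc (ginv a b F ω) (ginv a b F (q + (1 - q) * ω / q)) ∧
    ginv a b H (ω / q) ∈ QSet a b q (fun θ =>
        q * (if ginv a b F ω ≤ θ then (1 : ℝ) else 0)
          + (1 - q) * (if ginv a b F (q + (1 - q) * ω / q) ≤ θ then (1 : ℝ) else 0)) := by
  obtain ⟨hq0, hq1⟩ := hq
  obtain ⟨hω0, hωq⟩ := hω
  have hq1' : 0 < 1 - q := by linarith
  have hFb : F b = 1 := hF.2.2.2 b le_rfl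
  have hHb : H b = 1 := hH.2.2.2 b le_rfl
  have hr1 : ω / q ≤ 1 := (div_le_one hq0).2 hωq
  have hp : q + (1 - q) * ω / q ≤ 1 := by
    rw [mul_div_assoc]; nlinarith
  have hbdd : ∀ (G : ℝ → ℝ) (p : ℝ), BddBelow {θ | θ ∈ Set.Icc a b ∧ p ≤ G θ} :=
    fun G p => ⟨a, fun θ h => h.1.1⟩
  have hbmem : b ∈ Set.Icc a b := ⟨hab.le, le_rfl⟩
  have hHm : b ∈ {θ | θ ∈ Set.Icc a b ∧ ω / q ≤ H θ} := ⟨hbmem, by rw [hHb]; exact hr1⟩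
  have hL : ginv a b F ω ≤ ginv a b H (ω / q) := by
    refine csInf_le_csInf (hbdd _ _) ⟨b, hHm⟩ ?_
    rintro θ ⟨hθ, h⟩
    refine ⟨hθ, ?_⟩
    have h2 := h.trans ((hbounds θ hθ).2.trans (min_le_left _ _))
    exact (div_le_div_iff_of_pos_right hq0).1 h2
  have hU : ginv a b H (ω / q) ≤ ginv a b F (q + (1 - q) * ω / q) := by
    refine csInf_le_csInf (hbdd _ _) ⟨b, hbmem, by rw [hFb]; exact hp⟩ ?_
    rintro θ ⟨hθ, h⟩
    refine ⟨hθ, ?_⟩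
    refine le_trans ?_ ((le_max_right _ _).trans (hbounds θ hθ).1)
    rw [le_div_iff₀ hq1']
    rw [mul_div_assoc] at h
    linarith
  have hxa : a ≤ ginv a b H (ω / q) := le_csInf ⟨b, hHm⟩ fun θ h => h.1.1
  have hxb : ginv a b H (ω / q) ≤ b := csInf_le (hbdd _ _) hHm
  refine ⟨⟨hL, hU⟩, ⟨hxa, hxb⟩, ?_, ?_⟩
  · have hstep : ∀ c : ℝ, Monotone (fun θ : ℝ => if c ≤ θ then (1 : ℝ) else 0) := by
      intro c x y hxy
      dsimp only
      split_ifs <;> first | linarith | norm_num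
    have hmono := ((hstep (ginv a b F ω)).const_mul hq0.le).add
      ((hstep (ginv a b F (q + (1 - q) * ω / q))).const_mul hq1'.le)
    refine le_of_tendsto (hmono.tendsto_leftLim (ginv a b H (ω / q))) ?_
    filter_upwards [self_mem_nhdsWithin] with y hy
    have hy' : ¬ ginv a b F (q + (1 - q) * ω / q) ≤ y :=
      not_le.2 (lt_of_lt_of_le hy hU)
    rw [if_neg hy']
    split_ifs <;> linarith
  · dsimp only
    rw [if_pos hL]
    split_ifs <;> linarith
end
end

section
/- Suppose F has a positive density on Θ. Then the set of uniquely implementable distributions of posterior q-quantiles is dense in ℋ: every H ∈ ℋ is the weak* limit of a sequence of distributions each uniquely implemented by some experiment. -/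
open MeasureTheory Set Filter Topology

noncomputable section

/-- `H` is uniquely implemented by some experiment: a measurable selection of
`q`-quantiles has pushforward `H`, and the quantile set is a singleton `τ`-a.s. -/
def UniquelyImplementable (a b q : ℝ) (F H : ℝ → ℝ) : Prop :=
  ∃ τ : Measure {G : ℝ → ℝ // IsCDF a b G}, IsProbabilityMeasure τ ∧
    (∀ x : ℝ, (∫ G, (G : {G : ℝ → ℝ // IsCDF a b G}).1 x ∂τ) = F x) ∧
    (∃ χ : {G : ℝ → ℝ // IsCDF a b G} → ℝ, Measurable χ ∧
      (∀ G : {G : ℝ → ℝ // IsCDF a b G}, χ G ∈ QSet a b q G.1) ∧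
      ∀ x : ℝ, H x = (τ {G | χ G ≤ x}).toReal) ∧
    (∀ᵐ G ∂τ, ∃ x : ℝ, QSet a b q (G : {G : ℝ → ℝ // IsCDF a b G}).1 = {x})

abbrev UU := ↥(Set.Ioo (0 : ℝ) 1)

instance instMSUU : MeasureSpace UU := Measure.Subtype.measureSpace

abbrev CC (a b : ℝ) := {G : ℝ → ℝ // IsCDF a b G}

lemma map_val_UU : Measure.map Subtype.val (volume : Measure UU) =
    (volume : Measure ℝ).restrict (Ioo 0 1) := by
  have := map_comap_subtype_coe (α := ℝ) (s := Ioo (0 : ℝ) 1) measurableSet_Ioo volume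
  exact this

instance : IsProbabilityMeasure (volume : Measure UU) := by
  constructor
  have := congrArg (fun m => m univ) map_val_UU
  simp only [Measure.map_apply measurable_subtype_coe MeasurableSet.univ] at this
  simpa using this

lemma int_UU (g : ℝ → ℝ) : ∫ p in Set.Icc (0 : ℝ) 1, g p = ∫ p : UU, g p.1 := by
  rw [integral_Icc_eq_integral_Ioo]
  exact (integral_subtype_comap measurableSet_Ioo g).symm

lemma vol_UU_le (s : ℝ) : (volume : Measure UU) {p | p.1 ≤ s} = ENNReal.ofReal (min s 1) := by
  have h1 : (volume : Measure UU) {p | p.1 ≤ s} =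
      Measure.map Subtype.val (volume : Measure UU) (Iic s) := by
    rw [Measure.map_apply measurable_subtype_coe measurableSet_Iic]; rfl
  rw [h1, map_val_UU, Measure.restrict_congr_set Ioo_ae_eq_Ioc,
    Measure.restrict_apply measurableSet_Iic]
  have : Iic s ∩ Ioc 0 1 = Ioc 0 (min s 1) := by
    ext x; simp; tauto
  rw [this, Real.volume_Ioc, sub_zero]

lemma cdf_nonneg' {a b : ℝ} {G : ℝ → ℝ} (hG : IsCDF a b G) (x : ℝ) : 0 ≤ G x := by
  rcases lt_or_ge x a with h | h
  · rw [hG.2.2.1 x h]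
  · rw [← hG.2.2.1 (a - 1) (by linarith)]; exact hG.1 (by linarith)

lemma cdf_le_one' {a b : ℝ} {G : ℝ → ℝ} (hG : IsCDF a b G) (x : ℝ) : G x ≤ 1 := by
  rw [← hG.2.2.2 (max x b) (le_max_right _ _)]; exact hG.1 (le_max_left _ _)

lemma ginv_nonempty {a b p : ℝ} (hab : a ≤ b) {G : ℝ → ℝ} (hG : IsCDF a b G) (hp : p ≤ 1) :
    b ∈ {θ | θ ∈ Set.Icc a b ∧ p ≤ G θ} :=
  ⟨right_mem_Icc.2 hab, by rw [hG.2.2.2 b le_rfl]; exact hp⟩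

lemma ginv_bdd {a b p : ℝ} {G : ℝ → ℝ} :
    BddBelow {θ | θ ∈ Set.Icc a b ∧ p ≤ G θ} := ⟨a, fun _ h => h.1.1⟩

lemma ginv_mem {a b p : ℝ} (hab : a ≤ b) {G : ℝ → ℝ} (hG : IsCDF a b G) (hp : p ≤ 1) :
    ginv a b G p ∈ Icc a b :=
  ⟨le_csInf ⟨b, ginv_nonempty hab hG hp⟩ fun _ h => h.1.1,
    csInf_le ginv_bdd (ginv_nonempty hab hG hp)⟩

lemma le_of_right {G : ℝ → ℝ} {z p : ℝ} (hc : ContinuousWithinAt G (Set.Ici z) z)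
    (h : ∀ y, z < y → p ≤ G y) : p ≤ G z := by
  have h1 : Tendsto G (𝓝[>] z) (𝓝 (G z)) := hc.mono Ioi_subset_Ici_self
  exact ge_of_tendsto h1 (eventually_nhdsWithin_of_forall h)

lemma ginv_le {a b p : ℝ} (hab : a ≤ b) {G : ℝ → ℝ} (hG : IsCDF a b G) (hp : p ≤ 1) :
    p ≤ G (ginv a b G p) := by
  apply le_of_right (hG.2.1 _)
  intro y hy
  obtain ⟨t, ht, hty⟩ := exists_lt_of_csInf_lt ⟨b, ginv_nonempty hab hG hp⟩ hy
  exact ht.2.trans (hG.1 hty.le)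

lemma ginv_le_iff {a b p : ℝ} (hab : a ≤ b) {G : ℝ → ℝ} (hG : IsCDF a b G)
    (hp0 : 0 < p) (hp : p ≤ 1) (x : ℝ) : ginv a b G p ≤ x ↔ p ≤ G x := by
  constructor
  · intro h; exact (ginv_le hab hG hp).trans (hG.1 h)
  · intro h
    have hx : a ≤ x := by
      by_contra! hx
      rw [hG.2.2.1 x hx] at h; linarith
    rcases le_total x b with hb | hb
    · exact csInf_le ginv_bdd ⟨⟨hx, hb⟩, h⟩
    · exact (ginv_mem hab hG hp).2.trans hb

lemma ginv_mono {a b p r : ℝ} (hab : a ≤ b) {G : ℝ → ℝ} (hG : IsCDF a b G) (hr : r ≤ 1)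
    (h : p ≤ r) : ginv a b G p ≤ ginv a b G r :=
  csInf_le_csInf ginv_bdd ⟨b, ginv_nonempty hab hG hr⟩ fun _ ht => ⟨ht.1, h.trans ht.2⟩

lemma leftLim_le' {G : ℝ → ℝ} (hG : Monotone G) {z q : ℝ} (h : ∀ y, y < z → G y ≤ q) :
    Function.leftLim G z ≤ q :=
  le_of_tendsto (hG.tendsto_leftLim z) (eventually_nhdsWithin_of_forall h)

lemma ginv_mem_QSet {a b q : ℝ} (hab : a ≤ b) (hq : q ∈ Ioo (0 : ℝ) 1) {G : ℝ → ℝ}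
    (hG : IsCDF a b G) : ginv a b G q ∈ QSet a b q G := by
  refine ⟨ginv_mem hab hG hq.2.le, leftLim_le' hG.1 ?_, ginv_le hab hG hq.2.le⟩
  intro y hy
  by_contra! h
  exact absurd ((ginv_le_iff hab hG hq.1 hq.2.le y).2 h.le) (not_le.2 hy)

lemma QSet_unique {a b q z : ℝ} {G : ℝ → ℝ} (hG : IsCDF a b G) (hz : z ∈ Icc a b)
    (h1 : ∀ y, y < z → G y < q) (h2 : ∀ y, z < y → q < G y) : QSet a b q G = {z} := by
  ext x
  simp only [mem_singleton_iff]
  constructor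
  · rintro ⟨_, hl, hr⟩
    rcases lt_trichotomy x z with h | h | h
    · exact absurd hr (not_le.2 (h1 x h))
    · exact h
    · obtain ⟨m, hm1, hm2⟩ := exists_between h
      have := hG.1.le_leftLim hm2
      linarith [h2 m hm1]
  · rintro rfl
    exact ⟨hz, leftLim_le' hG.1 fun y hy => (h1 y hy).le,
      le_of_right (hG.2.1 _) fun y hy => (h2 y hy).le⟩

def qq (a b q : ℝ) (G : CC a b) : ℝ := ginv a b G.1 q

lemma measurable_eval (a b x : ℝ) : Measurable (fun G : CC a b => G.1 x) :=
  (measurable_pi_apply x).comp measurable_subtype_coe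

lemma measurable_qq {a b q : ℝ} (hab : a ≤ b) (hq : q ∈ Ioo (0 : ℝ) 1) :
    Measurable (qq a b q) := by
  apply measurable_of_Iic
  intro x
  have : qq a b q ⁻¹' Iic x = {G : CC a b | q ≤ G.1 x} := by
    ext G
    exact ginv_le_iff hab G.2 hq.1 hq.2.le x
  rw [this]
  exact measurableSet_le measurable_const (measurable_eval a b x)

lemma measurable_ginv {a b : ℝ} (hab : a ≤ b) {G : ℝ → ℝ} (hG : IsCDF a b G) :
    Measurable (fun p : UU => ginv a b G p.1) := by
  have : Monotone (fun p : UU => ginv a b G p.1) := fun p r h => ginv_mono hab hG r.2.2.le h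
  exact this.measurable

/-- Law of the quantile. -/
def law (a b q : ℝ) (τ : Measure (CC a b)) (x : ℝ) : ℝ := (τ {G | qq a b q G ≤ x}).toReal

lemma law_eq {a b q : ℝ} (hab : a ≤ b) (hq : q ∈ Ioo (0 : ℝ) 1) (τ : Measure (CC a b)) (x : ℝ) :
    law a b q τ x = (τ.map (qq a b q)).real (Iic x) := by
  rw [measureReal_def, Measure.map_apply (measurable_qq hab hq) measurableSet_Iic]; rfl

lemma law_cdf {a b q : ℝ} (hab : a ≤ b) (hq : q ∈ Ioo (0 : ℝ) 1) (τ : Measure (CC a b))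
    [IsProbabilityMeasure τ] : IsCDF a b (law a b q τ) := by
  have : IsProbabilityMeasure (τ.map (qq a b q)) :=
    Measure.isProbabilityMeasure_map (measurable_qq hab hq).aemeasurable
  have e : law a b q τ = ProbabilityTheory.cdf (τ.map (qq a b q)) := by
    funext x
    rw [law_eq hab hq, ProbabilityTheory.cdf_eq_real]
  refine ⟨?_, ?_, ?_, ?_⟩
  · rw [e]; exact (ProbabilityTheory.cdf _).mono
  · rw [e]; exact fun x => (ProbabilityTheory.cdf _).right_continuous x
  · intro x hx
    have : {G : CC a b | qq a b q G ≤ x} = ∅ := by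
      ext G
      simp only [mem_ofPred_eq, mem_empty_iff_false, iff_false, not_le]
      exact hx.trans_le (ginv_mem hab G.2 hq.2.le).1
    simp [law, this]
  · intro x hx
    have : {G : CC a b | qq a b q G ≤ x} = univ := by
      ext G
      simp only [mem_ofPred_eq, mem_univ, iff_true]
      exact (ginv_mem hab G.2 hq.2.le).2.trans hx
    simp [law, this]

lemma law_UI {a b q : ℝ} (hab : a ≤ b) (hq : q ∈ Ioo (0 : ℝ) 1) {F : ℝ → ℝ}
    (τ : Measure (CC a b)) [IsProbabilityMeasure τ]
    (hm : ∀ x : ℝ, (∫ G, G.1 x ∂τ) = F x)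
    (hu : ∀ᵐ G ∂τ, ∃ x : ℝ, QSet a b q G.1 = {x}) :
    UniquelyImplementable a b q F (law a b q τ) :=
  ⟨τ, inferInstance, hm, ⟨qq a b q, measurable_qq hab hq,
    fun G => ginv_mem_QSet hab hq G.2, fun _ => rfl⟩, hu⟩

lemma law_int {a b q : ℝ} (hab : a ≤ b) (hq : q ∈ Ioo (0 : ℝ) 1)
    (τ : Measure (CC a b)) [IsProbabilityMeasure τ] (V : ℝ → ℝ) (hV : Continuous V) :
    ∫ p : UU, V (ginv a b (law a b q τ) p.1) = ∫ G, V (qq a b q G) ∂τ := by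
  have hc := law_cdf hab hq τ
  have : IsProbabilityMeasure (τ.map (qq a b q)) :=
    Measure.isProbabilityMeasure_map (measurable_qq hab hq).aemeasurable
  have hg := measurable_ginv hab hc
  have e : Measure.map (fun p : UU => ginv a b (law a b q τ) p.1) volume = τ.map (qq a b q) := by
    apply Measure.ext_of_Iic
    intro x
    rw [Measure.map_apply hg measurableSet_Iic]
    have : (fun p : UU => ginv a b (law a b q τ) p.1) ⁻¹' Iic x =
        {p : UU | p.1 ≤ law a b q τ x} := by
      ext p
      exact ginv_le_iff hab hc p.2.1 p.2.2.le x
    rw [this, vol_UU_le, min_eq_left (cdf_le_one' hc x), law_eq hab hq]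
    exact ENNReal.ofReal_toReal (measure_ne_top _ _)
  rw [← integral_map (φ := fun p : UU => ginv a b (law a b q τ) p.1) hg.aemeasurable
      hV.aestronglyMeasurable, e,
    integral_map (measurable_qq hab hq).aemeasurable hV.aestronglyMeasurable]

def stp (z x : ℝ) : ℝ := if z ≤ x then 1 else 0

lemma stp_cdf {a b z : ℝ} (hz : z ∈ Icc a b) : IsCDF a b (stp z) := by
  refine ⟨?_, ?_, ?_, ?_⟩
  · intro x y h
    unfold stp
    split_ifs <;> linarith
  · intro x
    rcases le_or_gt z x with h | h
    · have : ∀ y ∈ Ici x, stp z y = 1 := fun y hy => if_pos (h.trans hy)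
      exact continuousWithinAt_const.congr this (this x self_mem_Ici)
    · have : (stp z) =ᶠ[𝓝 x] fun _ => 0 := by
        filter_upwards [Iio_mem_nhds h] with y hy
        exact if_neg (not_le.2 hy)
      exact (continuousAt_const.congr this.symm).continuousWithinAt
  · intro x hx
    exact if_neg (not_le.2 (hx.trans_le hz.1))
  · intro x hx
    exact if_pos (hz.2.trans hx)

lemma comb_cdf {a b s : ℝ} (h0 : 0 ≤ s) (h1 : s ≤ 1) {G K : ℝ → ℝ} (hG : IsCDF a b G)
    (hK : IsCDF a b K) : IsCDF a b (fun x => s * G x + (1 - s) * K x) := by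
  refine ⟨?_, ?_, ?_, ?_⟩
  · intro x y h
    have := mul_le_mul_of_nonneg_left (hG.1 h) h0
    have := mul_le_mul_of_nonneg_left (hK.1 h) (sub_nonneg.2 h1)
    dsimp only
    linarith
  · intro x
    exact ((hG.2.1 x).const_mul s).add ((hK.2.1 x).const_mul (1 - s))
  · intro x hx
    simp [hG.2.2.1 x hx, hK.2.2.1 x hx]
  · intro x hx
    simp [hG.2.2.2 x hx, hK.2.2.2 x hx]

lemma comp_cdf {a b : ℝ} {g F : ℝ → ℝ} (hF : IsCDF a b F) (hg : Monotone g) (hc : Continuous g)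
    (h0 : g 0 = 0) (h1 : g 1 = 1) : IsCDF a b (fun x => g (F x)) := by
  refine ⟨hg.comp hF.1, fun x => hc.continuousAt.comp_continuousWithinAt (hF.2.1 x), ?_, ?_⟩
  · intro x hx
    simp [hF.2.2.1 x hx, h0]
  · intro x hx
    simp [hF.2.2.2 x hx, h1]

def KK (q u t : ℝ) : ℝ := q * min (t / u) 1 + (1 - q) * max 0 ((t - u) / (1 - u))

section
variable {q u : ℝ}

lemma KK_mono (hq : q ∈ Ioo (0 : ℝ) 1) (hu : u ∈ Ioo (0 : ℝ) 1) : Monotone (KK q u) := by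
  intro s t h
  have h1 := hq.1.le
  have h2 := sub_nonneg.2 hq.2.le
  have h3 := hu.1.le
  have h4 := sub_nonneg.2 hu.2.le
  unfold KK
  gcongr

lemma KK_cont (q u : ℝ) : Continuous (KK q u) := by
  unfold KK
  fun_prop

lemma KK_zero (hu : u ∈ Ioo (0 : ℝ) 1) : KK q u 0 = 0 := by
  have : (0 - u) / (1 - u) ≤ 0 := div_nonpos_of_nonpos_of_nonneg (by linarith [hu.1])
    (by linarith [hu.2])
  simp only [KK, zero_div, max_eq_left this]
  simp

lemma KK_one (hu : u ∈ Ioo (0 : ℝ) 1) : KK q u 1 = 1 := by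
  have h1 : 1 ≤ 1 / u := by rw [le_div_iff₀ hu.1]; linarith [hu.2]
  have h2 : (1 - u) / (1 - u) = 1 := div_self (by linarith [hu.2])
  simp only [KK, min_eq_right h1, h2]
  simp

lemma KK_lt (hq : q ∈ Ioo (0 : ℝ) 1) (hu : u ∈ Ioo (0 : ℝ) 1) {t : ℝ} (ht : t < u) :
    KK q u t < q := by
  have : (t - u) / (1 - u) ≤ 0 := div_nonpos_of_nonpos_of_nonneg (by linarith)
    (by linarith [hu.2])
  have h2 : t / u < 1 := by rw [div_lt_one hu.1]; exact ht
  simp only [KK, max_eq_left this, min_eq_left h2.le]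
  nlinarith [hq.1]

lemma KK_gt (hq : q ∈ Ioo (0 : ℝ) 1) (hu : u ∈ Ioo (0 : ℝ) 1) {t : ℝ} (ht : u < t) :
    q < KK q u t := by
  have h1 : 0 < (t - u) / (1 - u) := div_pos (by linarith) (by linarith [hu.2])
  have h2 : 1 ≤ t / u := by rw [le_div_iff₀ hu.1]; linarith
  simp only [KK, min_eq_right h2, max_eq_right h1.le]
  have := mul_pos (sub_pos.2 hq.2) h1
  linarith

lemma KK_lip (hq : q ∈ Ioo (0 : ℝ) 1) {δ : ℝ} (hδ : 0 < δ) (hu : u ∈ Icc δ (1 - δ)) {s t : ℝ}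
    (h : s ≤ t) : δ * (KK q u t - KK q u s) ≤ t - s := by
  have hu0 : 0 < u := hδ.trans_le hu.1
  have hu1 : 0 < 1 - u := by linarith [hu.2]
  have a1 : δ * (t / u - s / u) ≤ t - s := by
    rw [← sub_div, mul_div_assoc', div_le_iff₀ hu0]
    nlinarith [hu.1]
  have a2 : δ * ((t - u) / (1 - u) - (s - u) / (1 - u)) ≤ t - s := by
    rw [← sub_div, mul_div_assoc', div_le_iff₀ hu1]
    nlinarith [hu.2]
  have b0 : s / u ≤ t / u := by gcongr
  have b1 : min (t / u) 1 - min (s / u) 1 ≤ t / u - s / u := by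
    rcases min_cases (t / u) 1 with h | h <;> rcases min_cases (s / u) 1 with h' | h' <;> linarith
  have c0 : (s - u) / (1 - u) ≤ (t - u) / (1 - u) := by gcongr
  have c1 : max 0 ((t - u) / (1 - u)) - max 0 ((s - u) / (1 - u)) ≤
      (t - u) / (1 - u) - (s - u) / (1 - u) := by
    rcases max_cases 0 ((t - u) / (1 - u)) with h | h <;>
    rcases max_cases 0 ((s - u) / (1 - u)) with h' | h' <;> linarith
  have d1 := (mul_le_mul_of_nonneg_left b1 hδ.le).trans a1
  have d2 := (mul_le_mul_of_nonneg_left c1 hδ.le).trans a2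
  have e1 := mul_le_mul_of_nonneg_left d1 hq.1.le
  have e2 := mul_le_mul_of_nonneg_left d2 (sub_nonneg.2 hq.2.le)
  unfold KK
  linarith

end

lemma KK_meas (q t : ℝ) : Measurable (fun u => KK q u t) := by
  unfold KK
  fun_prop

section
variable {q δ : ℝ} {u : UU → ℝ}

lemma KK_int (hq : q ∈ Ioo (0 : ℝ) 1) (hδ : 0 < δ) (hu : ∀ p, u p ∈ Icc δ (1 - δ))
    (hum : Measurable u) (t : ℝ) : Integrable (fun p => KK q (u p) t) := by
  have hu' : ∀ p, u p ∈ Ioo (0 : ℝ) 1 := fun p => ⟨hδ.trans_le (hu p).1, by linarith [(hu p).2]⟩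
  refine Integrable.of_bound (C := |t| / δ) ((KK_meas q t).comp hum).aestronglyMeasurable
    (Eventually.of_forall fun p => ?_)
  rw [Real.norm_eq_abs, le_div_iff₀ hδ]
  have z := KK_zero (q := q) (hu' p)
  rcases le_total 0 t with h | h
  · have h1 := KK_mono hq (hu' p) h
    have h2 := KK_lip hq hδ (hu p) h
    rw [z] at h1 h2
    rw [abs_of_nonneg h, abs_of_nonneg h1]
    linarith
  · have h1 := KK_mono hq (hu' p) h
    have h2 := KK_lip hq hδ (hu p) h
    rw [z] at h1 h2
    rw [abs_of_nonpos h, abs_of_nonpos h1]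
    linarith

def RR (q δ : ℝ) (u : UU → ℝ) (t : ℝ) : ℝ := (t - δ * ∫ p, KK q (u p) t) / (1 - δ)

lemma RR_props (hq : q ∈ Ioo (0 : ℝ) 1) (hδ : 0 < δ) (hδ1 : δ < 1)
    (hu : ∀ p, u p ∈ Icc δ (1 - δ))
    (hum : Measurable u) : Monotone (RR q δ u) ∧ Continuous (RR q δ u) ∧ RR q δ u 0 = 0 ∧
      RR q δ u 1 = 1 := by
  have hu' : ∀ p, u p ∈ Ioo (0 : ℝ) 1 := fun p => ⟨hδ.trans_le (hu p).1, by linarith [(hu p).2]⟩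
  have hI := KK_int hq hδ hu hum
  have h1 : ∀ s t, s ≤ t → ∫ p, KK q (u p) s ≤ ∫ p, KK q (u p) t := fun s t h =>
    integral_mono (hI s) (hI t) fun p => KK_mono hq (hu' p) h
  have h2 : ∀ s t, s ≤ t → δ * (∫ p, KK q (u p) t) - δ * ∫ p, KK q (u p) s ≤ t - s := by
    intro s t h
    rw [← mul_sub, ← integral_sub (hI t) (hI s), ← integral_const_mul]
    have : t - s = ∫ p : UU, (t - s) := by simp
    rw [this]
    exact integral_mono (((hI t).sub (hI s)).const_mul δ) (integrable_const _)
      fun p => KK_lip hq hδ (hu p) h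
  have hd : 0 < 1 - δ := by linarith
  refine ⟨?_, ?_, ?_, ?_⟩
  · intro s t h
    have := h2 s t h
    unfold RR
    gcongr ?_ / _
    linarith
  · have : LipschitzWith 1 (fun t => t - δ * ∫ p, KK q (u p) t) := by
      apply LipschitzWith.of_le_add_mul
      intro s t
      rw [Real.dist_eq]
      rcases le_total s t with h | h
      · have := h2 s t h
        have := abs_nonneg (s - t)
        simp only [NNReal.coe_one]
        linarith
      · have := mul_le_mul_of_nonneg_left (h1 t s h) hδ.le
        have := le_abs_self (s - t)
        simp only [NNReal.coe_one]
        linarith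
    exact this.continuous.div_const _
  · have : ∀ p, KK q (u p) 0 = 0 := fun p => KK_zero (hu' p)
    simp [RR, this]
  · have : ∀ p, KK q (u p) 1 = 1 := fun p => KK_one (hu' p)
    simp [RR, this]
    exact hd.ne'
end

lemma int_stp {a b x : ℝ} (hab : a ≤ b) {F : ℝ → ℝ} (hF : IsCDF a b F) (l : UU → ℝ) (s : ℝ)
    (hl : ∀ p, l p ∈ Ioo (0 : ℝ) 1) (hs0 : 0 ≤ s) (hs : s ≤ 1) (h : ∀ p : UU, l p ≤ F x ↔ p.1 ≤ s) :
    ∫ p, stp (ginv a b F (l p)) x = s := by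
  have : (fun p => stp (ginv a b F (l p)) x) = indicator {p : UU | p.1 ≤ s} 1 := by
    funext p
    rw [stp, indicator_apply]
    simp only [ginv_le_iff hab hF (hl p).1 (hl p).2.le, h, mem_ofPred_eq, Pi.one_apply]
  rw [this, integral_indicator_one (measurableSet_le measurable_subtype_coe measurable_const),
    measureReal_def, vol_UU_le, min_eq_left hs, ENNReal.toReal_ofReal hs0]

lemma unique_iff {a b q : ℝ} (hab : a ≤ b) (hq : q ∈ Ioo (0 : ℝ) 1) (G : CC a b) :
    (∃ x : ℝ, QSet a b q G.1 = {x}) ↔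
      ∀ m r : ℚ, m < r → ¬ (G.1 m = q ∧ G.1 r = q) := by
  have hG := G.2
  constructor
  · rintro ⟨x, hx⟩ m r hmr ⟨h1, h2⟩
    have hmem : ∀ y, G.1 y = q → y ∈ QSet a b q G.1 := by
      intro y hy
      refine ⟨⟨?_, ?_⟩, hy ▸ hG.1.leftLim_le le_rfl, hy.ge⟩
      · by_contra! h
        rw [hG.2.2.1 y h] at hy
        exact hq.1.ne hy
      · by_contra! h
        rw [hG.2.2.2 y h.le] at hy
        exact hq.2.ne' hy
    have e1 := hmem _ h1
    have e2 := hmem _ h2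
    rw [hx, mem_singleton_iff] at e1 e2
    have : (m : ℝ) < r := by exact_mod_cast hmr
    linarith
  · intro h
    refine ⟨_, eq_singleton_iff_unique_mem.2 ⟨ginv_mem_QSet hab hq hG, ?_⟩⟩
    have : ∀ x y, x ∈ QSet a b q G.1 → y ∈ QSet a b q G.1 → ¬ x < y := by
      intro x y hx hy hxy
      have hm : ∀ m, x < m → m < y → G.1 m = q := fun m h1 h2 =>
        le_antisymm ((hG.1.le_leftLim h2).trans hy.2.1) (hx.2.2.trans (hG.1 h1.le))
      obtain ⟨m, hm1, hm2⟩ := exists_rat_btwn hxy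
      obtain ⟨r, hr1, hr2⟩ := exists_rat_btwn hm2
      exact h m r (by exact_mod_cast hr1) ⟨hm m hm1 hm2, hm r (hm1.trans hr1) hr2⟩
    intro x hx
    have hz := ginv_mem_QSet hab hq hG
    exact le_antisymm (not_lt.1 (this _ _ hz hx)) (not_lt.1 (this _ _ hx hz))

lemma meas_unique {a b q : ℝ} (hab : a ≤ b) (hq : q ∈ Ioo (0 : ℝ) 1) :
    MeasurableSet {G : CC a b | ∃ x : ℝ, QSet a b q G.1 = {x}} := by
  have : {G : CC a b | ∃ x : ℝ, QSet a b q G.1 = {x}} =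
      ⋂ (m : ℚ) (r : ℚ) (_ : m < r), ({G : CC a b | G.1 m = q} ∩ {G : CC a b | G.1 r = q})ᶜ := by
    ext G
    simp only [mem_ofPred_eq, unique_iff hab hq, mem_iInter, mem_compl_iff, mem_inter_iff]
  rw [this]
  refine MeasurableSet.iInter fun m => MeasurableSet.iInter fun r => MeasurableSet.iInter fun _ => ?_
  exact ((measurableSet_eq_fun (measurable_eval a b m) measurable_const).inter
    (measurableSet_eq_fun (measurable_eval a b r) measurable_const)).compl

lemma qq_of_unique {a b q z : ℝ} (hab : a ≤ b) (hq : q ∈ Ioo (0 : ℝ) 1) (G : CC a b)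
    (h : QSet a b q G.1 = {z}) : qq a b q G = z := by
  have := ginv_mem_QSet hab hq G.2
  rw [h] at this
  exact this

lemma meas_stp {g : UU → ℝ} (hg : Measurable g) (x : ℝ) : Measurable (fun p => stp (g p) x) := by
  unfold stp
  exact Measurable.ite (measurableSet_le hg measurable_const) measurable_const measurable_const

lemma stp_int {g : UU → ℝ} (hg : Measurable g) (x : ℝ) : Integrable (fun p => stp (g p) x) := by
  refine Integrable.of_bound (C := 1) (meas_stp hg x).aestronglyMeasurable
    (Eventually.of_forall fun p => ?_)
  unfold stp
  split_ifs <;> simp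

lemma meas_ginv_comp {a b : ℝ} (hab : a ≤ b) {F : ℝ → ℝ} (hF : IsCDF a b F) {l : UU → ℝ}
    (hl : ∀ p, l p ∈ Ioo (0 : ℝ) 1) (hm : Measurable l) :
    Measurable (fun p => ginv a b F (l p)) := by
  have : Measurable (fun p => (⟨l p, hl p⟩ : UU)) := hm.subtype_mk
  exact (measurable_ginv hab hF).comp this

lemma core {a b q δ : ℝ} (hab : a < b) (hq : q ∈ Ioo (0 : ℝ) 1) {F : ℝ → ℝ} (hF : IsCDF a b F)
    (hFs : StrictMonoOn F (Icc a b)) (hδ : 0 < δ) (hδ1 : δ < 1) {u : UU → ℝ} (hum : Measurable u)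
    (hu : ∀ p, u p ∈ Icc δ (1 - δ))
    (hu1 : ∀ p : UU, q * p.1 ≤ u p) (hu2 : ∀ p : UU, u p ≤ q + (1 - q) * p.1) :
    ∃ τ : Measure (CC a b), IsProbabilityMeasure τ ∧ (∀ x : ℝ, (∫ G, G.1 x ∂τ) = F x) ∧
      (∀ᵐ G ∂τ, ∃ x : ℝ, QSet a b q G.1 = {x}) ∧
      ∃ W : UU → ℝ, (∀ p, W p ∈ Icc a b) ∧ ∀ V : ℝ → ℝ, Continuous V → (∃ C, ∀ x, |V x| ≤ C) →
        ∫ G, V (qq a b q G) ∂τ = (1 - δ + δ ^ 2) * (∫ p, V (ginv a b F (u p))) +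
          (δ * (1 - δ)) * ∫ p, V (W p) := by
  have hq0 := hq.1
  have hq1 := hq.2
  have hq1' : 0 < 1 - q := by linarith
  have hu' : ∀ p, u p ∈ Ioo (0 : ℝ) 1 := fun p => ⟨hδ.trans_le (hu p).1, by linarith [(hu p).2]⟩
  obtain ⟨r1, r2, r3, r4⟩ := RR_props hq hδ hδ1 hu hum
  set c := 1 - δ + δ ^ 2 with hc
  have hd : 0 < 1 - δ := by linarith
  have hc0 : 0 < c := by positivity
  set α := (1 - δ) / c with hα
  have hα0 : 0 ≤ α := by positivity
  have hα1 : α < 1 := by rw [hα, div_lt_one hc0, hc]; nlinarith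
  have hcα : c * α = 1 - δ := by rw [hα]; field_simp
  have hcα' : c * (1 - α) = δ ^ 2 := by rw [mul_sub, hcα, hc]; ring
  let l1 : UU → ℝ := fun p => q * p.1
  let l2 : UU → ℝ := fun p => q + (1 - q) * p.1
  have hl1 : ∀ p, l1 p ∈ Ioo (0 : ℝ) 1 := fun p => by
    have := p.2.1; have := p.2.2
    constructor <;> simp only [l1]
    · positivity
    · nlinarith
  have hl2 : ∀ p, l2 p ∈ Ioo (0 : ℝ) 1 := fun p => by
    have := p.2.1; have := p.2.2
    constructor <;> simp only [l2]
    · positivity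
    · nlinarith
  have ml1 : Measurable l1 := measurable_subtype_coe.const_mul q
  have ml2 : Measurable l2 := (measurable_subtype_coe.const_mul (1 - q)).const_add q
  have mg1 := meas_ginv_comp hab.le hF hl1 ml1
  have mg2 := meas_ginv_comp hab.le hF hl2 ml2
  have hK : ∀ p, IsCDF a b (fun x => KK q (u p) (F x)) := fun p =>
    comp_cdf hF (KK_mono hq (hu' p)) (KK_cont q (u p)) (KK_zero (hu' p)) (KK_one (hu' p))
  have hR : IsCDF a b (fun x => RR q δ u (F x)) := comp_cdf hF r1 r2 r3 r4
  let g1 : UU → ℝ → ℝ := fun p x => α * (q * stp (ginv a b F (l1 p)) x +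
    (1 - q) * stp (ginv a b F (l2 p)) x) + (1 - α) * KK q (u p) (F x)
  have hg1 : ∀ p, IsCDF a b (g1 p) := fun p =>
    comb_cdf hα0 hα1.le (comb_cdf hq0.le hq1.le (stp_cdf (ginv_mem hab.le hF (hl1 p).2.le))
      (stp_cdf (ginv_mem hab.le hF (hl2 p).2.le))) (hK p)
  let W : UU → ℝ := fun p => ginv a b (fun x => RR q δ u (F x)) p.1
  have hW : ∀ p, W p ∈ Icc a b := fun p => ginv_mem hab.le hR p.2.2.le
  have mW : Measurable W := measurable_ginv hab.le hR
  let Γ1 : UU → CC a b := fun p => ⟨g1 p, hg1 p⟩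
  let Γ2 : UU → CC a b := fun p => ⟨stp (W p), stp_cdf (hW p)⟩
  have mΓ1 : Measurable Γ1 := by
    apply Measurable.subtype_mk
    rw [measurable_pi_iff]
    intro x
    exact ((((meas_stp mg1 x).const_mul q).add ((meas_stp mg2 x).const_mul (1 - q))).const_mul α).add
      (((KK_meas q (F x)).comp hum).const_mul (1 - α))
  have mΓ2 : Measurable Γ2 := by
    apply Measurable.subtype_mk
    rw [measurable_pi_iff]
    intro x
    exact meas_stp mW x
  have U1 : ∀ p, QSet a b q (Γ1 p).1 = {ginv a b F (u p)} := by
    intro p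
    have hz := ginv_mem hab.le hF (hu' p).2.le
    apply QSet_unique (hg1 p) hz
    · intro y hy
      have hy' : F y < u p := by
        by_contra! h
        exact absurd ((ginv_le_iff hab.le hF (hu' p).1 (hu' p).2.le y).2 h) (not_le.2 hy)
      have s2 : stp (ginv a b F (l2 p)) y = 0 := by
        apply if_neg
        rw [ginv_le_iff hab.le hF (hl2 p).1 (hl2 p).2.le]
        exact not_le.2 (hy'.trans_le (hu2 p))
      have s1 : stp (ginv a b F (l1 p)) y ≤ 1 := by unfold stp; split_ifs <;> norm_num
      have k := KK_lt hq (hu' p) hy'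
      change α * (q * stp (ginv a b F (l1 p)) y +
        (1 - q) * stp (ginv a b F (l2 p)) y) + (1 - α) * KK q (u p) (F y) < q
      rw [s2]
      have e1 := mul_le_mul_of_nonneg_left (mul_le_mul_of_nonneg_left s1 hq0.le) hα0
      have e2 := mul_lt_mul_of_pos_left k (sub_pos.2 hα1)
      linarith
    · intro y hy
      have hy' : u p < F y := by
        have h1 := ginv_le hab.le hF (hu' p).2.le
        rcases le_or_gt y b with hb | hb
        · exact h1.trans_lt (hFs hz ⟨hz.1.trans hy.le, hb⟩ hy)
        · rw [hF.2.2.2 y hb.le]; exact (hu' p).2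
      have s1 : stp (ginv a b F (l1 p)) y = 1 := by
        apply if_pos
        rw [ginv_le_iff hab.le hF (hl1 p).1 (hl1 p).2.le]
        exact (hu1 p).trans hy'.le
      have s2 : 0 ≤ stp (ginv a b F (l2 p)) y := by unfold stp; split_ifs <;> norm_num
      have k := KK_gt hq (hu' p) hy'
      change q < α * (q * stp (ginv a b F (l1 p)) y +
        (1 - q) * stp (ginv a b F (l2 p)) y) + (1 - α) * KK q (u p) (F y)
      rw [s1]
      have e1 := mul_nonneg hα0 (mul_nonneg hq1'.le s2)
      have e2 := mul_lt_mul_of_pos_left k (sub_pos.2 hα1)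
      linarith
  have U2 : ∀ p, QSet a b q (Γ2 p).1 = {W p} := by
    intro p
    apply QSet_unique (Γ2 p).2 (hW p)
    · intro y hy
      have : (Γ2 p).1 y = 0 := if_neg (not_le.2 hy)
      rw [this]; exact hq0
    · intro y hy
      have : (Γ2 p).1 y = 1 := if_pos hy.le
      rw [this]; exact hq1
  let τ : Measure (CC a b) := ENNReal.ofReal c • (volume : Measure UU).map Γ1 +
    ENNReal.ofReal (δ * (1 - δ)) • (volume : Measure UU).map Γ2
  have P1 : IsProbabilityMeasure ((volume : Measure UU).map Γ1) :=
    Measure.isProbabilityMeasure_map mΓ1.aemeasurable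
  have P2 : IsProbabilityMeasure ((volume : Measure UU).map Γ2) :=
    Measure.isProbabilityMeasure_map mΓ2.aemeasurable
  have hdd : 0 ≤ δ * (1 - δ) := by positivity
  have key : ∀ φ : CC a b → ℝ, Measurable φ → (∃ C, ∀ G, |φ G| ≤ C) →
      ∫ G, φ G ∂τ = c * (∫ p, φ (Γ1 p)) + (δ * (1 - δ)) * ∫ p, φ (Γ2 p) := by
    rintro φ hφ ⟨C, hC⟩
    have i1 : Integrable φ ((volume : Measure UU).map Γ1) :=
      Integrable.of_bound (C := C) hφ.aestronglyMeasurable (Eventually.of_forall hC)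
    have i2 : Integrable φ ((volume : Measure UU).map Γ2) :=
      Integrable.of_bound (C := C) hφ.aestronglyMeasurable (Eventually.of_forall hC)
    rw [integral_add_measure (i1.smul_measure ENNReal.ofReal_ne_top)
      (i2.smul_measure ENNReal.ofReal_ne_top), integral_smul_measure, integral_smul_measure,
      integral_map mΓ1.aemeasurable hφ.aestronglyMeasurable,
      integral_map mΓ2.aemeasurable hφ.aestronglyMeasurable, ENNReal.toReal_ofReal hc0.le,
      ENNReal.toReal_ofReal hdd]
    rfl
  refine ⟨τ, ⟨?_⟩, ?_, ?_, W, hW, ?_⟩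
  · simp only [τ, Measure.add_apply, Measure.smul_apply, measure_univ, smul_eq_mul, mul_one]
    rw [← ENNReal.ofReal_add hc0.le hdd, hc]
    ring_nf
    simp
  · intro x
    rw [key _ (measurable_eval a b x) ⟨1, fun G => by
      rw [abs_of_nonneg (cdf_nonneg' G.2 x)]; exact cdf_le_one' G.2 x⟩]
    have F0 := cdf_nonneg' hF x
    have F1 := cdf_le_one' hF x
    have I1 : ∫ p, stp (ginv a b F (l1 p)) x = min (F x / q) 1 := by
      apply int_stp hab.le hF l1 _ hl1
      · positivity
      · exact min_le_right _ _
      · intro p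
        simp only [l1, le_min_iff, p.2.2.le, and_true]
        rw [le_div_iff₀ hq0, mul_comm]
    have I2 : ∫ p, stp (ginv a b F (l2 p)) x = max 0 ((F x - q) / (1 - q)) := by
      apply int_stp hab.le hF l2 _ hl2
      · exact le_max_left _ _
      · apply max_le zero_le_one
        rw [div_le_one hq1']; linarith
      · intro p
        simp only [l2, le_max_iff, not_le.2 p.2.1, false_or]
        rw [le_div_iff₀ hq1', mul_comm]
        constructor <;> intro h <;> linarith
    have I3 : ∫ p, stp (W p) x = RR q δ u (F x) := by
      apply int_stp hab.le hR (fun p => p.1) _ (fun p => p.2) (cdf_nonneg' hR x) (cdf_le_one' hR x)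
      intro p; rfl
    have J1 : ∫ p, (Γ1 p).1 x = α * (q * min (F x / q) 1 + (1 - q) * max 0 ((F x - q) / (1 - q)))
        + (1 - α) * ∫ p, KK q (u p) (F x) := by
      change ∫ p, (α * (q * stp (ginv a b F (l1 p)) x +
        (1 - q) * stp (ginv a b F (l2 p)) x) + (1 - α) * KK q (u p) (F x)) = _
      have A1 := (stp_int mg1 x).const_mul q
      have A2 := (stp_int mg2 x).const_mul (1 - q)
      have A12 : Integrable (fun p => α * (q * stp (ginv a b F (l1 p)) x +
        (1 - q) * stp (ginv a b F (l2 p)) x)) := (A1.add A2).const_mul α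
      have A3 := (KK_int hq hδ hu hum (F x)).const_mul (1 - α)
      rw [integral_add A12 A3, integral_const_mul, integral_add A1 A2,
        integral_const_mul, integral_const_mul, integral_const_mul, I1, I2]
    have J2 : q * min (F x / q) 1 + (1 - q) * max 0 ((F x - q) / (1 - q)) = F x := by
      rcases le_total (F x) q with h | h
      · rw [min_eq_left ((div_le_one hq0).2 h), max_eq_left
          (div_nonpos_of_nonpos_of_nonneg (by linarith) hq1'.le)]
        field_simp
        ring
      · rw [min_eq_right ((one_le_div hq0).2 h), max_eq_right
          (div_nonneg (by linarith) hq1'.le)]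
        field_simp
        ring
    rw [J1, J2]
    change _ + _ * (∫ p, stp (W p) x) = _
    rw [I3, mul_add, ← mul_assoc, ← mul_assoc, hcα, hcα', RR]
    field_simp
    ring
  · rw [ae_add_measure_iff]
    have hs : ∀ (e : ENNReal) (Γ : UU → CC a b), Measurable Γ →
        (∀ p, ∃ x, QSet a b q (Γ p).1 = {x}) →
        ∀ᵐ G ∂(e • (volume : Measure UU).map Γ), ∃ x : ℝ, QSet a b q G.1 = {x} := by
      intro e Γ hΓ h
      apply Measure.ae_smul_measure
      rw [ae_map_iff hΓ.aemeasurable (meas_unique hab.le hq)]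
      exact Eventually.of_forall h
    exact ⟨hs _ _ mΓ1 fun p => ⟨_, U1 p⟩, hs _ _ mΓ2 fun p => ⟨_, U2 p⟩⟩
  · rintro V hV ⟨C, hC⟩
    rw [key (fun G => V (qq a b q G)) (hV.measurable.comp (measurable_qq hab.le hq))
      ⟨C, fun G => hC _⟩]
    simp only [fun p => qq_of_unique hab.le hq _ (U1 p), fun p => qq_of_unique hab.le hq _ (U2 p)]

lemma dens_tail {a b q : ℝ} (hab : a < b)
    (hq : q ∈ Set.Ioo (0 : ℝ) 1) {F : ℝ → ℝ} (hF : IsCDF a b F)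
    (hFs : StrictMonoOn F (Icc a b)) (hFc : ContinuousOn F (Icc a b)) (hFa : F a = 0)
    (H : ℝ → ℝ) (hH : IsCDF a b H)
    (hbounds : ∀ x ∈ Set.Icc a b,
      max 0 ((F x - q) / (1 - q)) ≤ H x ∧ H x ≤ min (F x / q) 1) :
    ∃ Hn : ℕ → ℝ → ℝ,
      (∀ n : ℕ, IsCDF a b (Hn n) ∧ UniquelyImplementable a b q F (Hn n)) ∧
      ∀ V : ℝ → ℝ, ContinuousOn V (Set.Icc a b) →
        Tendsto (fun n => ∫ p in Set.Icc (0 : ℝ) 1, V (ginv a b (Hn n) p)) atTop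
          (𝓝 (∫ p in Set.Icc (0 : ℝ) 1, V (ginv a b H p))) := by
  have hq0 := hq.1
  have hq1 : 0 < 1 - q := by linarith [hq.2]
  let y : UU → ℝ := fun p => ginv a b H p.1
  have hy : ∀ p, y p ∈ Icc a b := fun p => ginv_mem hab.le hH p.2.2.le
  have my : Measurable y := measurable_ginv hab.le hH
  have b1 : ∀ p : UU, q * p.1 ≤ F (y p) := by
    intro p
    have h1 : p.1 ≤ H (y p) := ginv_le hab.le hH p.2.2.le
    have h2 := (h1.trans (hbounds _ (hy p)).2).trans (min_le_left _ _)
    rw [le_div_iff₀ hq0] at h2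
    linarith
  have b2 : ∀ p : UU, F (y p) ≤ q + (1 - q) * p.1 := by
    intro p
    have hp := p.2.1
    rcases (hy p).1.eq_or_lt with h | h
    · rw [← h, hFa]; positivity
    · have hc : Tendsto F (𝓝[<] (y p)) (𝓝 (F (y p))) := by
        have h1 := (hFc (y p) (hy p)).mono (Ico_subset_Icc_self.trans (Icc_subset_Icc_right (hy p).2))
        rw [← nhdsWithin_Ico_eq_nhdsLT h]
        exact h1
      refine le_of_tendsto hc ?_
      filter_upwards [Ioo_mem_nhdsLT h] with z hz
      have hz1 : H z < p.1 := by
        by_contra! h'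
        exact absurd ((ginv_le_iff hab.le hH p.2.1 p.2.2.le z).2 h') (not_le.2 hz.2)
      have h3 := (le_max_right _ _).trans (hbounds z ⟨hz.1.le, hz.2.le.trans (hy p).2⟩).1
      rw [div_le_iff₀ hq1] at h3
      nlinarith
  let δ : ℕ → ℝ := fun n => min q (1 - q) / ((n : ℝ) + 2)
  have hm : 0 < min q (1 - q) := lt_min hq0 hq1
  have hδ : ∀ n, 0 < δ n := fun n => by positivity
  have hδm : ∀ n, δ n ≤ min q (1 - q) / 2 := fun n => by
    have : (0 : ℝ) ≤ n := n.cast_nonneg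
    simp only [δ]
    gcongr
    linarith
  have hδq : ∀ n, δ n ≤ q := fun n => by linarith [hδm n, min_le_left q (1 - q)]
  have hδq' : ∀ n, δ n ≤ 1 - q := fun n => by linarith [hδm n, min_le_right q (1 - q)]
  have hδ2 : ∀ n, δ n ≤ 1 - δ n := fun n => by
    linarith [hδm n, min_le_left q (1 - q), min_le_right q (1 - q)]
  have hδ1 : ∀ n, δ n < 1 := fun n => by linarith [hδq n, hq.2]
  have hδt : Tendsto δ atTop (𝓝 0) :=
    tendsto_const_nhds.div_atTop (tendsto_natCast_atTop_atTop.atTop_add tendsto_const_nhds)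
  let u : ℕ → UU → ℝ := fun n p => max (δ n) (min (1 - δ n) (F (y p)))
  have mu : ∀ n, Measurable (u n) := fun n =>
    measurable_const.max (measurable_const.min (hF.1.measurable.comp my))
  have hu : ∀ n p, u n p ∈ Icc (δ n) (1 - δ n) := fun n p =>
    ⟨le_max_left _ _, max_le (hδ2 n) (min_le_left _ _)⟩
  have hu1 : ∀ n (p : UU), q * p.1 ≤ u n p := by
    intro n p
    have hp := p.2.2
    refine le_max_of_le_right (le_min ?_ (b1 p))
    nlinarith [hδq' n]
  have hu2 : ∀ n (p : UU), u n p ≤ q + (1 - q) * p.1 := by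
    intro n p
    have hp := p.2.1
    refine max_le ?_ ((min_le_right _ _).trans (b2 p))
    have := mul_pos hq1 hp
    linarith [hδq n]
  choose τ hτ hmean huniq W hW hint using fun n =>
    core hab hq hF hFs (hδ n) (hδ1 n) (mu n) (hu n) (hu1 n) (hu2 n)
  refine ⟨fun n => law a b q (τ n), fun n => ⟨law_cdf hab.le hq (τ n),
    law_UI hab.le hq (τ n) (hmean n) (huniq n)⟩, ?_⟩
  intro V0 hV0
  let V : ℝ → ℝ := fun x => V0 (projIcc a b hab.le x)
  have hV : Continuous V :=
    (continuousOn_iff_continuous_domRestrict.1 hV0).comp continuous_projIcc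
  have hVe : ∀ x ∈ Icc a b, V0 x = V x := fun x hx => by
    simp only [V, projIcc_of_mem hab.le hx]
  obtain ⟨C, hC⟩ : ∃ C, ∀ x, |V x| ≤ C := by
    obtain ⟨C, hC⟩ := isCompact_Icc.exists_bound_of_continuousOn hV0
    exact ⟨C, fun x => hC _ (projIcc a b hab.le x).2⟩
  have conv : ∀ G, IsCDF a b G → ∫ p in Set.Icc (0 : ℝ) 1, V0 (ginv a b G p) =
      ∫ p : UU, V (ginv a b G p.1) := by
    intro G hG
    rw [int_UU (fun p => V0 (ginv a b G p))]
    congr 1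
    funext p
    exact hVe _ (ginv_mem hab.le hG p.2.2.le)
  rw [conv H hH]
  have e : ∀ n, ∫ p in Set.Icc (0 : ℝ) 1, V0 (ginv a b (law a b q (τ n)) p) =
      (1 - δ n + δ n ^ 2) * (∫ p, V (ginv a b F (u n p))) +
          (δ n * (1 - δ n)) * ∫ p, V (W n p) := by
    intro n
    rw [conv _ (law_cdf hab.le hq (τ n)), law_int hab.le hq (τ n) V hV, hint n V hV ⟨C, hC⟩]
  simp only [e]
  have t1 : Tendsto (fun n => ∫ p, V (ginv a b F (u n p))) atTop (𝓝 (∫ p, V (y p))) := by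
    refine tendsto_integral_of_dominated_convergence (fun _ => C) ?_ (integrable_const _) ?_ ?_
    · intro n
      have hu' : ∀ p, u n p ∈ Ioo (0 : ℝ) 1 := fun p =>
        ⟨(hδ n).trans_le (hu n p).1, by linarith [(hu n p).2, hδ n]⟩
      exact (hV.measurable.comp (meas_ginv_comp hab.le hF hu' (mu n))).aestronglyMeasurable
    · exact fun n => Eventually.of_forall fun p => hC _
    · refine Eventually.of_forall fun p => ?_
      have f0 : 0 < F (y p) := (mul_pos hq0 p.2.1).trans_le (b1 p)
      have f1 : F (y p) < 1 := (b2 p).trans_lt (by nlinarith [p.2.2])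
      have ev : ∀ᶠ n in atTop, V (y p) = V (ginv a b F (u n p)) := by
        filter_upwards [hδt.eventually_lt_const f0,
          hδt.eventually_lt_const (sub_pos.2 f1)] with n h1 h2
        have : u n p = F (y p) := by
          simp only [u]
          rw [min_eq_right (by linarith), max_eq_right h1.le]
        rw [this]
        congr 1
        apply le_antisymm
        · by_contra! h
          have g := ginv_le hab.le hF f1.le
          exact absurd (hFs (ginv_mem hab.le hF f1.le) (hy p) h) (not_lt.2 g)
        · exact (ginv_le_iff hab.le hF f0 f1.le _).2 le_rfl
      exact tendsto_const_nhds.congr' ev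
  have t2 : Tendsto (fun n => (δ n * (1 - δ n)) * ∫ p, V (W n p)) atTop (𝓝 0) := by
    have z : Tendsto (fun n => δ n * (1 - δ n)) atTop (𝓝 0) := by
      simpa using hδt.mul (hδt.const_sub 1)
    refine z.zero_mul_isBoundedUnder_le (isBoundedUnder_of ⟨C, fun n => ?_⟩)
    have := norm_integral_le_of_norm_le_const (μ := (volume : Measure UU)) (f := fun p => V (W n p)) (C := C)
      (Eventually.of_forall fun p => hC (W n p))
    simpa using this
  have t3 : Tendsto (fun n => 1 - δ n + δ n ^ 2) atTop (𝓝 1) := by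
    simpa using (hδt.const_sub 1).add (hδt.pow 2)
  simpa using (t3.mul t1).add t2

/-- if `F` has a positive density, every `H ∈ ℋ` is a weak* limit of
uniquely implementable distributions of posterior `q`-quantiles. -/
theorem uniquely_implementable_dense (a b q : ℝ) (hab : a < b)
    (hq : q ∈ Set.Ioo (0 : ℝ) 1) (F f : ℝ → ℝ) (hF : IsCDF a b F)
    (hf_pos : ∀ x ∈ Set.Icc a b, 0 < f x)
    (hf_int : IntegrableOn f (Set.Icc a b))
    (hFf : ∀ x ∈ Set.Icc a b, F x = ∫ t in Set.Icc a x, f t)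
    (H : ℝ → ℝ) (hH : IsCDF a b H)
    (hbounds : ∀ x ∈ Set.Icc a b,
      max 0 ((F x - q) / (1 - q)) ≤ H x ∧ H x ≤ min (F x / q) 1) :
    ∃ Hn : ℕ → ℝ → ℝ,
      (∀ n : ℕ, IsCDF a b (Hn n) ∧ UniquelyImplementable a b q F (Hn n)) ∧
      ∀ V : ℝ → ℝ, ContinuousOn V (Set.Icc a b) →
        Tendsto (fun n => ∫ p in Set.Icc (0 : ℝ) 1, V (ginv a b (Hn n) p)) atTop
          (𝓝 (∫ p in Set.Icc (0 : ℝ) 1, V (ginv a b H p))) := by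
  have hFc : ContinuousOn F (Icc a b) :=
    (intervalIntegral.continuousOn_primitive_Icc hf_int).congr hFf
  have hFa : F a = 0 := by
    rw [hFf a (left_mem_Icc.2 hab.le)]; simp
  have hFs : StrictMonoOn F (Icc a b) := by
    intro x hx y hy hxy
    have i1 : IntervalIntegrable f volume a x :=
      (intervalIntegrable_iff_integrableOn_Icc_of_le hx.1).2
        (hf_int.mono_set (Icc_subset_Icc_right hx.2))
    have i2 : IntervalIntegrable f volume x y :=
      (intervalIntegrable_iff_integrableOn_Icc_of_le hxy.le).2
        (hf_int.mono_set (Icc_subset_Icc hx.1 hy.2))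
    have e : ∀ z ∈ Icc a b, F z = ∫ t in a..z, f t := fun z hz => by
      rw [hFf z hz, intervalIntegral.integral_of_le hz.1, integral_Icc_eq_integral_Ioc]
    have h := intervalIntegral.intervalIntegral_pos_of_pos_on i2
      (fun z hz => hf_pos z ⟨hx.1.trans hz.1.le, hz.2.le.trans hy.2⟩) hxy
    rw [e x hx, e y hy, ← intervalIntegral.integral_add_adjacent_intervals i1 i2]
    linarith
  exact dens_tail hab hq hF hFs hFc hFa H hH hbounds
end
end
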